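/- (Fenchel–Moreau on Wasserstein space) Let φ : P₁ → ℝ ∪ {+∞} be proper, convex and lower semicontinuous with respect to the Wasserstein metric W₁. Define the conjugate ρ(f) = sup_{μ ∈ P₁} (∫ f dμ − φ(μ)) for Lipschitz f, and the biconjugate φᶜ(μ) = sup_{f Lipschitz} (∫ f dμ − ρ(f)). Then φ(μ) = φᶜ(μ) for every μ ∈ P₁. -/

import Mathlib

open MeasureTheory
open scoped NNReal

/-- The Wasserstein distance of order 1, defined as the infimum of expected distances
over all couplings. -/
noncomputable def W1 {X : Type*} [MetricSpace X] [MeasurableSpace X] (μ ν : Measure X) : ℝ :=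
  sInf {c : ℝ | ∃ π : Measure (X × X), IsProbabilityMeasure π ∧
    π.map Prod.fst = μ ∧ π.map Prod.snd = ν ∧ c = ∫ p, dist p.1 p.2 ∂π}

/-- Membership in the Wasserstein space of order 1: a Borel probability measure with
finite first moment. -/
def MemP1 {X : Type*} [MetricSpace X] [MeasurableSpace X] (x₀ : X) (μ : Measure X) : Prop :=
  IsProbabilityMeasure μ ∧ Integrable (fun x => dist x₀ x) μ

section helpers
set_option linter.unusedSectionVars false
open Filter Topology ProbabilityTheory

variable {X : Type*} [MetricSpace X] [MeasurableSpace X]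

def Cpl (x₀ : X) (α β : Measure X) (c : ℝ) : Prop :=
  ∃ π : Measure (X × X), IsFiniteMeasure π ∧ Integrable (fun p => dist x₀ p.1) π ∧
    Integrable (fun p => dist x₀ p.2) π ∧ π.map Prod.fst = α ∧ π.map Prod.snd = β ∧
    ∫ p, dist p.1 p.2 ∂π ≤ c

theorem Cpl.nonneg {x₀ : X} {α β : Measure X} {c : ℝ} (h : Cpl x₀ α β c) : 0 ≤ c := by
  obtain ⟨π, _, _, _, _, _, h⟩ := h
  exact le_trans (integral_nonneg fun _ => dist_nonneg) h

theorem Cpl.mono {x₀ : X} {α β : Measure X} {c c' : ℝ} (h : Cpl x₀ α β c) (hc : c ≤ c') :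
    Cpl x₀ α β c' := by
  obtain ⟨π, h0, h1, h2, h3, h4, h⟩ := h
  exact ⟨π, h0, h1, h2, h3, h4, h.trans hc⟩

theorem Cpl.fin_left {x₀ : X} {α β : Measure X} {c : ℝ} (h : Cpl x₀ α β c) :
    IsFiniteMeasure α := by
  obtain ⟨π, _, _, _, rfl, _, h⟩ := h
  infer_instance

theorem Cpl.fin_right {x₀ : X} {α β : Measure X} {c : ℝ} (h : Cpl x₀ α β c) :
    IsFiniteMeasure β := by
  obtain ⟨π, _, _, _, _, rfl, h⟩ := h
  infer_instance

variable [BorelSpace X] [SecondCountableTopology X]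

theorem int_dist {x₀ : X} {Ω : Type*} [MeasurableSpace Ω] {π : Measure Ω} {f g : Ω → X}
    (hf : Measurable f) (hg : Measurable g)
    (h1 : Integrable (fun p => dist x₀ (f p)) π) (h2 : Integrable (fun p => dist x₀ (g p)) π) :
    Integrable (fun p => dist (f p) (g p)) π := by
  refine (h1.add h2).mono' (hf.dist hg).aestronglyMeasurable (ae_of_all _ fun p => ?_)
  rw [Real.norm_of_nonneg dist_nonneg]
  simpa using dist_triangle_left (f p) (g p) x₀

theorem Cpl.int_left {x₀ : X} {α β : Measure X} {c : ℝ} (h : Cpl x₀ α β c) :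
    Integrable (fun x => dist x₀ x) α := by
  obtain ⟨π, _, h1, _, rfl, _, h⟩ := h
  rw [integrable_map_measure (by fun_prop) (by fun_prop)]
  exact h1

theorem Cpl.int_right {x₀ : X} {α β : Measure X} {c : ℝ} (h : Cpl x₀ α β c) :
    Integrable (fun x => dist x₀ x) β := by
  obtain ⟨π, _, _, h1, _, rfl, h⟩ := h
  rw [integrable_map_measure (by fun_prop) (by fun_prop)]
  exact h1

theorem Cpl.of_map {x₀ : X} {Ω : Type*} [MeasurableSpace Ω] {π : Measure Ω} [IsFiniteMeasure π]
    {f g : Ω → X} (hf : Measurable f) (hg : Measurable g)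
    (h1 : Integrable (fun p => dist x₀ (f p)) π) (h2 : Integrable (fun p => dist x₀ (g p)) π) :
    Cpl x₀ (π.map f) (π.map g) (∫ p, dist (f p) (g p) ∂π) := by
  refine ⟨π.map (fun p => (f p, g p)), inferInstance, ?_, ?_, ?_, ?_, ?_⟩
  · rw [integrable_map_measure (by fun_prop) (by fun_prop)]; exact h1
  · rw [integrable_map_measure (by fun_prop) (by fun_prop)]; exact h2
  · rw [Measure.map_map (by fun_prop) (by fun_prop)]; rfl
  · rw [Measure.map_map (by fun_prop) (by fun_prop)]; rfl
  · rw [integral_map (by fun_prop) (by fun_prop)]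

theorem Cpl.symm {x₀ : X} {α β : Measure X} {c : ℝ} (h : Cpl x₀ α β c) : Cpl x₀ β α c := by
  obtain ⟨π, _, h1, h2, rfl, rfl, h⟩ := h
  refine (Cpl.of_map measurable_snd measurable_fst h2 h1).mono ?_
  simpa [dist_comm] using h

theorem Cpl.refl {x₀ : X} {α : Measure X} [IsFiniteMeasure α]
    (h : Integrable (fun x => dist x₀ x) α) : Cpl x₀ α α 0 := by
  simpa using Cpl.of_map measurable_id measurable_id h h

theorem Cpl.add {x₀ : X} {α β α' β' : Measure X} {c c' : ℝ} (h : Cpl x₀ α β c)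
    (h' : Cpl x₀ α' β' c') : Cpl x₀ (α + α') (β + β') (c + c') := by
  obtain ⟨π, _, h1, h2, rfl, rfl, h⟩ := h
  obtain ⟨π', _, h1', h2', rfl, rfl, h'⟩ := h'
  refine ⟨π + π', inferInstance, h1.add_measure h1', h2.add_measure h2',
    Measure.map_add _ _ measurable_fst, Measure.map_add _ _ measurable_snd, ?_⟩
  rw [integral_add_measure (int_dist measurable_fst measurable_snd h1 h2)
    (int_dist measurable_fst measurable_snd h1' h2')]
  exact add_le_add h h'

theorem Cpl.smul {x₀ : X} {α β : Measure X} {c t : ℝ} (ht : 0 ≤ t) (h : Cpl x₀ α β c) :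
    Cpl x₀ (ENNReal.ofReal t • α) (ENNReal.ofReal t • β) (t * c) := by
  obtain ⟨π, _, h1, h2, rfl, rfl, h⟩ := h
  refine ⟨ENNReal.ofReal t • π, Measure.smul_finite _ (by simp), h1.smul_measure (by simp),
    h2.smul_measure (by simp),
    Measure.map_smul _ _ _, Measure.map_smul _ _ _, ?_⟩
  rw [integral_smul_measure, ENNReal.toReal_ofReal ht]
  exact mul_le_mul_of_nonneg_left h ht

theorem Cpl.trans [StandardBorelSpace X] {x₀ : X} {α β γ : Measure X} {c c' : ℝ}
    (h : Cpl x₀ α β c) (h' : Cpl x₀ β γ c') : Cpl x₀ α γ (c + c') := by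
  have : Nonempty X := ⟨x₀⟩
  obtain ⟨π, _, h1, h2, rfl, rfl, h⟩ := h
  obtain ⟨ρ, _, h1', h2', h3', rfl, h'⟩ := h'
  let τ : Measure ((X × X) × X) := π ⊗ₘ (ρ.condKernel.comap Prod.snd measurable_snd)
  have e1 : τ.map Prod.fst = π := Measure.fst_compProd _ _
  have e2 : τ.map (fun p => (p.1.2, p.2)) = ρ := by
    conv_rhs => rw [← ρ.disintegrate ρ.condKernel]
    have : ρ.fst = π.map Prod.snd := h3'
    rw [this]
    ext s hs
    rw [Measure.map_apply (by fun_prop) hs, Measure.compProd_apply hs,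
      Measure.compProd_apply (hs.preimage (by fun_prop)),
      lintegral_map (Kernel.measurable_kernel_prodMk_left hs) measurable_snd]
    rfl
  have i1 : Integrable (fun p => dist x₀ p.1.1) τ := by
    rw [← e1, integrable_map_measure (by fun_prop) (by fun_prop)] at h1
    exact h1
  have i2 : Integrable (fun p => dist x₀ p.1.2) τ := by
    rw [← e1, integrable_map_measure (by fun_prop) (by fun_prop)] at h2
    exact h2
  have i3 : Integrable (fun p => dist x₀ p.2) τ := by
    rw [← e2, integrable_map_measure (by fun_prop) (by fun_prop)] at h2'
    exact h2'
  have c1 : ∫ p, dist p.1.1 p.1.2 ∂τ ≤ c := by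
    rw [← e1, integral_map (by fun_prop) (by fun_prop)] at h
    exact h
  have c2 : ∫ p, dist p.1.2 p.2 ∂τ ≤ c' := by
    rw [← e2, integral_map (by fun_prop) (by fun_prop)] at h'
    exact h'
  have key := Cpl.of_map (π := τ) (f := fun p => p.1.1) (g := fun p => p.2)
    (by fun_prop) (by fun_prop) i1 i3
  have m1 : τ.map (fun p => p.1.1) = π.map Prod.fst := by
    conv_rhs => rw [← e1, Measure.map_map (by fun_prop) (by fun_prop)]
    rfl
  have m2 : τ.map (fun p => p.2) = ρ.map Prod.snd := by
    conv_rhs => rw [← e2, Measure.map_map (by fun_prop) (by fun_prop)]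
    rfl
  rw [m1, m2] at key
  refine key.mono (le_trans ?_ (add_le_add c1 c2))
  have j1 := int_dist (x₀ := x₀) (π := τ) (f := fun p => p.1.1) (g := fun p => p.1.2)
    (by fun_prop) (by fun_prop) i1 i2
  have j2 := int_dist (x₀ := x₀) (π := τ) (f := fun p => p.1.2) (g := fun p => p.2)
    (by fun_prop) (by fun_prop) i2 i3
  rw [← integral_add j1 j2]
  exact integral_mono (int_dist (x₀ := x₀) (by fun_prop) (by fun_prop) i1 i3) (j1.add j2)
    fun p => dist_triangle _ _ _

theorem Cpl.prod {x₀ : X} {μ σ : Measure X} [IsProbabilityMeasure μ] [IsFiniteMeasure σ]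
    (hμ : Integrable (fun x => dist x₀ x) μ) (hσ : Integrable (fun x => dist x₀ x) σ) :
    ∃ c, Cpl x₀ (ENNReal.ofReal (σ.real Set.univ) • μ) σ c := by
  refine ⟨_, μ.prod σ, inferInstance, hμ.comp_fst σ, hσ.comp_snd μ, ?_, ?_, le_rfl⟩
  · rw [Measure.map_fst_prod]; simp
  · rw [Measure.map_snd_prod]; simp

theorem Cpl.chain [StandardBorelSpace X] {x₀ : X} {μ ν σ : Measure X} {w : ℝ}
    [IsFiniteMeasure μ] [IsFiniteMeasure ν]
    (hμ : Integrable (fun x => dist x₀ x) μ) (hν : Integrable (fun x => dist x₀ x) ν)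
    [IsFiniteMeasure σ] (hσ : Integrable (fun x => dist x₀ x) σ)
    (h : Cpl x₀ (μ + σ) (ν + σ) w) (n : ℕ) :
    Cpl x₀ (ENNReal.ofReal n • μ + σ) (ENNReal.ofReal n • ν + σ) (n * w) := by
  induction n with
  | zero => simpa using Cpl.refl hσ
  | succ n ih =>
    have a := ih.add (Cpl.refl hμ)
    have b := h.add ((Cpl.refl hν).smul (t := (n : ℝ)) (by positivity))
    have e : ∀ μ : Measure X, ENNReal.ofReal ((n + 1 : ℕ) : ℝ) • μ
        = ENNReal.ofReal n • μ + μ := by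
      intro μ
      rw [Nat.cast_succ, ENNReal.ofReal_add (by positivity) (by positivity), add_smul]; simp
    have e1 : ENNReal.ofReal n • ν + σ + μ = μ + σ + ENNReal.ofReal n • ν := by abel
    rw [e1] at a
    have c := a.trans b
    rw [e, e]
    convert c using 1
    · abel
    · abel
    · push_cast; ring

theorem W1_le {x₀ : X} {μ ν : Measure X} [IsProbabilityMeasure μ] {c : ℝ} (h : Cpl x₀ μ ν c) :
    W1 μ ν ≤ c := by
  obtain ⟨π, _, h1, h2, h3, h4, h⟩ := h
  refine le_trans (csInf_le ⟨0, ?_⟩ ⟨π, ?_, h3, h4, rfl⟩) h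
  · rintro _ ⟨π, _, _, _, rfl⟩
    exact integral_nonneg fun _ => dist_nonneg
  · constructor
    have : π.map Prod.fst Set.univ = 1 := by rw [h3]; simp
    rwa [Measure.map_apply measurable_fst MeasurableSet.univ, Set.preimage_univ] at this

theorem W1_nonneg (μ ν : Measure X) : 0 ≤ W1 μ ν := by
  apply Real.sInf_nonneg
  rintro _ ⟨π, _, _, _, rfl⟩
  exact integral_nonneg fun _ => dist_nonneg

theorem W1_cancel [StandardBorelSpace X] {x₀ : X} {μ ν α β : Measure X} {w : ℝ}
    (hμ : MemP1 x₀ μ) (hν : MemP1 x₀ ν) (h : Cpl x₀ α β w) (e : α + ν = β + μ) :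
    W1 μ ν ≤ w := by
  obtain ⟨_, hμ⟩ := hμ
  obtain ⟨_, hν⟩ := hν
  have := h.fin_right
  have hβ := h.int_right
  have h' := h.add (Cpl.refl hν)
  rw [e, add_comm β μ, add_comm β ν, add_zero] at h'
  obtain ⟨c1, h1⟩ := Cpl.prod hμ hβ
  obtain ⟨c2, h2⟩ := Cpl.prod hν hβ
  set s := β.real Set.univ
  have hs : 0 ≤ s := measureReal_nonneg
  have key : ∀ n : ℕ, 1 ≤ n → W1 μ ν * (n + s) ≤ c1 + n * w + c2 := by
    intro n hn
    have hn' : (1 : ℝ) ≤ n := by exact_mod_cast hn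
    have a := (Cpl.refl hμ).smul (t := (n : ℝ)) (by positivity) |>.add h1
    have b := (Cpl.refl hν).smul (t := (n : ℝ)) (by positivity) |>.add h2
    have t := (a.trans (h'.chain hμ hν hβ n)).trans b.symm
    rw [← add_smul, ← add_smul, ← ENNReal.ofReal_add (by positivity) hs] at t
    have t' := t.smul (t := (n + s)⁻¹) (by positivity)
    rw [smul_smul, smul_smul, ← ENNReal.ofReal_mul (by positivity),
      inv_mul_cancel₀ (by positivity), ENNReal.ofReal_one, one_smul, one_smul] at t'
    have := W1_le t'
    rw [inv_mul_eq_div, le_div_iff₀ (by positivity)] at this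
    linarith
  by_contra! hlt
  obtain ⟨n, hn⟩ := exists_nat_gt ((c1 + c2 - s * W1 μ ν) / (W1 μ ν - w))
  rw [div_lt_iff₀ (by linarith)] at hn
  have := key (n + 1) (by omega)
  push_cast at this
  nlinarith

theorem hb_sep {V : Type*} [AddCommGroup V] [Module ℝ V] (p : Seminorm ℝ V) (S : Set (V × ℝ))
    (hS : Convex ℝ S) (v0 : V) (a ε : ℝ) (hε : 0 < ε)
    (h : ∀ q ∈ S, p (q.1 - v0) < ε → |q.2 - a| < ε → False) :
    ∃ (l : V →ₗ[ℝ] ℝ) (C : ℝ≥0) (b u : ℝ), (∀ v, |l v| ≤ C * p v) ∧ l v0 + b * a < u ∧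
      ∀ q ∈ S, u ≤ l q.1 + b * q.2 := by
  let i1 : SeminormedAddCommGroup V := p.toAddGroupSeminorm.toSeminormedAddCommGroup
  have hn : ∀ v : V, ‖v‖ = p v := fun v => rfl
  let i2 : NormedSpace ℝ V := { norm_smul_le := fun r v => (map_smul_eq_mul p r v).le }
  obtain ⟨f, u, h1, h2⟩ := geometric_hahn_banach_open (convex_ball (v0, a) ε)
    Metric.isOpen_ball hS (by
      rw [Set.disjoint_left]
      intro q hq hqS
      rw [mem_ball_iff_norm, Prod.norm_def, max_lt_iff] at hq
      exact h q hqS hq.1 hq.2)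
  have e : ∀ q : V × ℝ, f q = f (q.1, 0) + f (0, 1) * q.2 := by
    intro q
    have : q = (q.1, 0) + q.2 • ((0 : V), (1 : ℝ)) := by ext <;> simp
    conv_lhs => rw [this]
    rw [map_add, map_smul, smul_eq_mul, mul_comm]
  refine ⟨f.toLinearMap.comp (LinearMap.inl ℝ V ℝ), ‖f‖₊, f (0, 1), u, ?_, ?_, ?_⟩
  · intro v
    have := f.le_opNorm (v, 0)
    rw [Prod.norm_def] at this
    simpa [hn] using this
  · have := h1 _ (Metric.mem_ball_self hε)
    rw [e] at this
    simpa using this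
  · intro q hq
    have := h2 q hq
    rw [e] at this
    simpa using this

abbrev MS (X : Type*) [MeasurableSpace X] := {s : Set X // MeasurableSet s} → ℝ

def JJ (μ : Measure X) : MS X := fun s => μ.real s.1

theorem JJ_add (μ ν : Measure X) [IsFiniteMeasure μ] [IsFiniteMeasure ν] :
    JJ (μ + ν) = JJ μ + JJ ν := by
  ext s; exact measureReal_add_apply

theorem JJ_smul (μ : Measure X) {t : ℝ} (ht : 0 ≤ t) :
    JJ (ENNReal.ofReal t • μ) = t • JJ μ := by
  ext s; simp [JJ, ht]

theorem JJ_inj {μ ν : Measure X} [IsFiniteMeasure μ] [IsFiniteMeasure ν] (h : JJ μ = JJ ν) :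
    μ = ν := by
  ext s hs
  have := congrFun h ⟨s, hs⟩
  simpa [JJ, measureReal_def, ENNReal.toReal_eq_toReal_iff'] using this

def KR (x₀ : X) (v : MS X) (c : ℝ) : Prop := ∃ α β, Cpl x₀ α β c ∧ v = JJ α - JJ β

theorem KR.nonneg {x₀ : X} {v : MS X} {c : ℝ} (h : KR x₀ v c) : 0 ≤ c := by
  obtain ⟨α, β, h, -⟩ := h
  exact h.nonneg

theorem KR.add {x₀ : X} {v w : MS X} {c d : ℝ} (h : KR x₀ v c) (h' : KR x₀ w d) :
    KR x₀ (v + w) (c + d) := by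
  obtain ⟨α, β, h, rfl⟩ := h
  obtain ⟨α', β', h', rfl⟩ := h'
  have := h.fin_left
  have := h.fin_right
  have := h'.fin_left
  have := h'.fin_right
  refine ⟨_, _, h.add h', ?_⟩
  rw [JJ_add, JJ_add]; abel

theorem KR.smul {x₀ : X} {v : MS X} {c : ℝ} (r : ℝ) (h : KR x₀ v c) :
    KR x₀ (r • v) (|r| * c) := by
  obtain ⟨α, β, h, rfl⟩ := h
  rcases le_total 0 r with hr | hr
  · rw [abs_of_nonneg hr]
    exact ⟨_, _, h.smul hr, by rw [JJ_smul _ hr, JJ_smul _ hr, smul_sub]⟩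
  · rw [abs_of_nonpos hr]
    have hr' : 0 ≤ -r := by linarith
    exact ⟨_, _, h.symm.smul hr', by rw [JJ_smul _ hr', JJ_smul _ hr']; module⟩

theorem KR.zero (x₀ : X) : KR x₀ (0 : MS X) 0 :=
  ⟨0, 0, Cpl.refl (integrable_zero_measure), by simp⟩

def V0 (x₀ : X) : Submodule ℝ (MS X) where
  carrier := {v | ∃ c, KR x₀ v c}
  add_mem' := by
    rintro v w ⟨c, h⟩ ⟨d, h'⟩
    exact ⟨_, h.add h'⟩
  zero_mem' := ⟨0, KR.zero x₀⟩
  smul_mem' := by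
    rintro r v ⟨c, h⟩
    exact ⟨_, h.smul r⟩

noncomputable def krSemi (x₀ : X) : Seminorm ℝ (V0 x₀) :=
  Seminorm.ofSMulLE (fun v => sInf {c | KR x₀ v.1 c})
    (le_antisymm (csInf_le ⟨0, fun _ h => h.nonneg⟩ (KR.zero x₀))
      (Real.sInf_nonneg fun _ h => h.nonneg))
    (by
      intro v w
      refine le_of_forall_pos_lt_add fun ε hε => ?_
      obtain ⟨c, hc, hc'⟩ := Real.lt_sInf_add_pos (s := {c | KR x₀ v.1 c}) v.2 (half_pos hε)
      obtain ⟨d, hd, hd'⟩ := Real.lt_sInf_add_pos (s := {c | KR x₀ w.1 c}) w.2 (half_pos hε)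
      have : sInf {c | KR x₀ (v + w).1 c} ≤ c + d :=
        csInf_le ⟨0, fun _ h => h.nonneg⟩ (hc.add hd)
      linarith)
    (by
      intro r v
      change _ ≤ |r| * _
      rw [← smul_eq_mul, ← Real.sInf_smul_of_nonneg (abs_nonneg r)]
      refine csInf_le_csInf ⟨0, fun _ h => h.nonneg⟩ (Set.Nonempty.smul_set v.2) ?_
      rintro _ ⟨c, hc, rfl⟩
      exact hc.smul r)

theorem krSemi_le {x₀ : X} {v : V0 x₀} {c : ℝ} (h : KR x₀ v.1 c) : krSemi x₀ v ≤ c :=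
  csInf_le ⟨0, fun _ h => h.nonneg⟩ h

theorem krSemi_lt {x₀ : X} {v : V0 x₀} {c : ℝ} (h : krSemi x₀ v < c) :
    ∃ d < c, KR x₀ v.1 d := by
  obtain ⟨d, hd, h'⟩ := exists_lt_of_csInf_lt (s := {c | KR x₀ v.1 c}) v.2 h
  exact ⟨d, h', hd⟩

theorem W1_le_KR [StandardBorelSpace X] {x₀ : X} {μ ν : Measure X} {w : ℝ}
    (hμ : MemP1 x₀ μ) (hν : MemP1 x₀ ν) (h : KR x₀ (JJ μ - JJ ν) w) : W1 μ ν ≤ w := by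
  obtain ⟨α, β, h, e⟩ := h
  refine W1_cancel hμ hν h ?_
  have := h.fin_left
  have := h.fin_right
  have := hμ.1
  have := hν.1
  apply JJ_inj
  rw [JJ_add, JJ_add]
  linear_combination (exp := 1) -e

theorem memP1_dirac (x₀ x : X) : MemP1 x₀ (Measure.dirac x) :=
  ⟨inferInstance, integrable_dirac (by simp)⟩

theorem KR_dirac (x₀ x y : X) : KR x₀ (JJ (Measure.dirac x) - JJ (Measure.dirac y)) (dist x y) := by
  refine ⟨_, _, ⟨Measure.dirac (x, y), inferInstance, ?_, ?_, ?_, ?_, ?_⟩, rfl⟩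
  · exact integrable_dirac (by simp)
  · exact integrable_dirac (by simp)
  · exact Measure.map_dirac' measurable_fst _
  · exact Measure.map_dirac' measurable_snd _
  · simp

theorem KR_base {x₀ : X} {μ : Measure X} (hμ : MemP1 x₀ μ) :
    ∃ c, KR x₀ (JJ μ - JJ (Measure.dirac x₀)) c := by
  obtain ⟨_, h⟩ := hμ
  refine ⟨_, _, _, Cpl.of_map (f := id) (g := fun _ => x₀) measurable_id measurable_const h
    (by simp), ?_⟩
  simp

theorem int_simple (μ : Measure X) [IsFiniteMeasure μ] (T : SimpleFunc X X) (h : X → ℝ) :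
    ∫ x, h (T x) ∂μ = ∑ y ∈ T.range, μ.real (T ⁻¹' {y}) * h y := by
  classical
  have : ∀ x, h (T x) = ∑ y ∈ T.range, (T ⁻¹' {y}).indicator (fun _ => h y) x := by
    intro x
    rw [Finset.sum_eq_single (T x)]
    · simp
    · intro y _ hy
      simp [Ne.symm hy]
    · intro hx
      exact absurd (T.mem_range_self x) hx
  simp_rw [this]
  rw [integral_finsetSum]
  · refine Finset.sum_congr rfl fun y _ => ?_
    rw [integral_indicator_const _ (T.measurableSet_fiber y), smul_eq_mul]
  · intro y _
    exact (integrable_const _).indicator (T.measurableSet_fiber y)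

theorem JJ_simple (μ : Measure X) [IsFiniteMeasure μ] (T : SimpleFunc X X) :
    JJ (μ.map T) = ∑ y ∈ T.range, μ.real (T ⁻¹' {y}) • JJ (Measure.dirac y) := by
  classical
  ext ⟨s, hs⟩
  have := int_simple μ T (s.indicator 1)
  rw [Finset.sum_apply]
  have e : ∫ x, s.indicator (1 : X → ℝ) (T x) ∂μ = JJ (μ.map T) ⟨s, hs⟩ := by
    have : (fun x => s.indicator (1 : X → ℝ) (T x)) = (T ⁻¹' s).indicator 1 := by
      ext x; simp [Set.indicator]
    rw [this, integral_indicator_one (T.measurable hs)]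
    simp [JJ, map_measureReal_apply T.measurable hs]
  rw [← e, this]
  refine Finset.sum_congr rfl fun y _ => ?_
  simp only [JJ, Pi.smul_apply, smul_eq_mul, measureReal_def, Measure.dirac_apply' _ hs]
  by_cases hy : y ∈ s <;> simp [hy]

theorem lip_int {x₀ : X} {f : X → ℝ} {C : ℝ≥0} (hf : LipschitzWith C f) {μ : Measure X}
    (hμ : MemP1 x₀ μ) : Integrable f μ := by
  obtain ⟨_, h⟩ := hμ
  refine ((h.const_mul (C : ℝ)).add (integrable_const |f x₀|)).mono'
    hf.continuous.aestronglyMeasurable (ae_of_all _ fun x => ?_)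
  have := hf.dist_le_mul x x₀
  rw [Real.dist_eq, dist_comm] at this
  have h2 := abs_sub_abs_le_abs_sub (f x) (f x₀)
  simp only [Real.norm_eq_abs, Pi.add_apply]
  linarith

theorem repr_lip {x₀ : X} (l : MS X →ₗ[ℝ] ℝ) (C : ℝ≥0)
    (hl : ∀ v c, KR x₀ v c → |l v| ≤ C * c) :
    ∃ f : X → ℝ, LipschitzWith C f ∧
      ∀ μ, MemP1 x₀ μ → l (JJ μ - JJ (Measure.dirac x₀)) = ∫ x, f x ∂μ := by
  let f : X → ℝ := fun x => l (JJ (Measure.dirac x) - JJ (Measure.dirac x₀))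
  have hf : LipschitzWith C f := by
    refine LipschitzWith.of_dist_le_mul fun x y => ?_
    rw [Real.dist_eq, ← map_sub]
    convert hl _ _ (KR_dirac x₀ x y) using 3
    abel
  refine ⟨f, hf, fun μ hμ => ?_⟩
  have hfi := lip_int hf hμ
  obtain ⟨_, hμi⟩ := hμ
  let T : ℕ → SimpleFunc X X := fun n =>
    SimpleFunc.approxOn id measurable_id Set.univ x₀ (Set.mem_univ _) n
  have hT1 : ∀ n x, dist x (T n x) ≤ dist x₀ x := by
    intro n x
    have := SimpleFunc.edist_approxOn_le (f := id) measurable_id (s := Set.univ) (Set.mem_univ x₀) x n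
    rw [edist_dist, edist_dist, ENNReal.ofReal_le_ofReal_iff dist_nonneg] at this
    rw [dist_comm x]
    exact this
  have hT0 : ∀ n, Integrable (fun x => dist x₀ (T n x)) μ := by
    intro n
    refine (hμi.add hμi).mono' (measurable_const.dist (T n).measurable).aestronglyMeasurable
      (ae_of_all _ fun x => ?_)
    rw [Real.norm_of_nonneg dist_nonneg]
    have := dist_triangle x₀ x (T n x)
    have := hT1 n x
    simp only [Pi.add_apply]
    linarith
  have hT2 : Tendsto (fun n => ∫ x, dist x (T n x) ∂μ) atTop (𝓝 0) := by
    have := tendsto_integral_of_dominated_convergence (μ := μ)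
      (F := fun n x => dist x (T n x)) (f := fun _ => (0 : ℝ)) (fun x => dist x₀ x)
      (fun n => (measurable_id.dist (T n).measurable).aestronglyMeasurable) hμi
      (fun n => ae_of_all _ fun x => by
        rw [Real.norm_of_nonneg dist_nonneg]; exact hT1 n x)
      (ae_of_all _ fun x => by
        have h := SimpleFunc.tendsto_approxOn (f := id) measurable_id (s := Set.univ)
          (Set.mem_univ x₀) (x := x) (by simp)
        have := (tendsto_const_nhds (x := x)).dist h
        simpa using this)
    simpa using this
  have key : ∀ n, |l (JJ μ - JJ (Measure.dirac x₀)) - ∫ x, f x ∂μ|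
      ≤ 2 * C * ∫ x, dist x (T n x) ∂μ := by
    intro n
    have a1 : |l (JJ μ - JJ (μ.map (T n)))| ≤ C * ∫ x, dist x (T n x) ∂μ := by
      refine hl _ _ ⟨_, _, Cpl.of_map (f := id) (g := T n) measurable_id (T n).measurable hμi
        (hT0 n), ?_⟩
      simp
    have a2 : l (JJ (μ.map (T n)) - JJ (Measure.dirac x₀)) = ∫ x, f (T n x) ∂μ := by
      have hone : ∑ y ∈ (T n).range, μ.real (T n ⁻¹' {y}) = 1 := by
        have := int_simple μ (T n) (fun _ => 1)
        simpa using this.symm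
      rw [int_simple μ (T n) f, JJ_simple, map_sub, map_sum]
      simp only [f, map_sub, mul_sub, Finset.sum_sub_distrib, ← Finset.sum_mul, hone, map_smul,
        smul_eq_mul, one_mul]
    have hfT : Integrable (fun x => f (T n x)) μ := ((T n).map f).integrable_of_isFiniteMeasure
    have a3 : |∫ x, f (T n x) ∂μ - ∫ x, f x ∂μ| ≤ C * ∫ x, dist x (T n x) ∂μ := by
      rw [← integral_sub hfT hfi, ← integral_const_mul]
      refine (abs_integral_le_integral_abs).trans (integral_mono (hfT.sub hfi).abs
        ((int_dist measurable_id (T n).measurable hμi (hT0 n)).const_mul _) fun x => ?_)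
      have := hf.dist_le_mul (T n x) x
      rwa [Real.dist_eq, dist_comm (T n x)] at this
    have a4 : l (JJ μ - JJ (Measure.dirac x₀)) = l (JJ μ - JJ (μ.map (T n))) +
        l (JJ (μ.map (T n)) - JJ (Measure.dirac x₀)) := by
      rw [← map_add]; congr 1; abel
    rw [a4, a2]
    rw [abs_le] at *
    constructor <;> linarith [a1.1, a1.2, a3.1, a3.2]
  have := ge_of_tendsto' (hT2.const_mul (2 * (C : ℝ))) key
  rw [mul_zero] at this
  exact sub_eq_zero.1 (abs_nonpos_iff.1 this)

theorem MemP1.mix {x₀ : X} {μ ν : Measure X} (hμ : MemP1 x₀ μ) (hν : MemP1 x₀ ν) {t : ℝ}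
    (h0 : 0 ≤ t) (h1 : t ≤ 1) :
    MemP1 x₀ (ENNReal.ofReal t • μ + ENNReal.ofReal (1 - t) • ν) := by
  obtain ⟨_, hμ⟩ := hμ
  obtain ⟨_, hν⟩ := hν
  refine ⟨⟨?_⟩, (hμ.smul_measure (by simp)).add_measure (hν.smul_measure (by simp))⟩
  simp [← ENNReal.ofReal_add h0 (sub_nonneg.2 h1)]

theorem sep_main [StandardBorelSpace X] (x₀ : X)
    (φ : Measure X → EReal) (hbot : ∀ μ, MemP1 x₀ μ → φ μ ≠ ⊥)
    (hconv : ∀ μ, MemP1 x₀ μ → ∀ ν, MemP1 x₀ ν → ∀ t : ℝ, 0 ≤ t → t ≤ 1 →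
      φ ((ENNReal.ofReal t) • μ + (ENNReal.ofReal (1 - t)) • ν) ≤
        (t : EReal) * φ μ + ((1 - t : ℝ) : EReal) * φ ν)
    (hlsc : ∀ μ : ℕ → Measure X, (∀ n, MemP1 x₀ (μ n)) → ∀ ν, MemP1 x₀ ν →
      Filter.Tendsto (fun n => W1 (μ n) ν) Filter.atTop (nhds 0) →
      φ ν ≤ Filter.liminf (fun n => φ (μ n)) Filter.atTop)
    (μ : Measure X) (hμ : MemP1 x₀ μ) (a : ℝ) (ha : (a : EReal) < φ μ) :
    ∃ (f : X → ℝ) (C : ℝ≥0) (b u : ℝ), LipschitzWith C f ∧ ∫ x, f x ∂μ + b * a < u ∧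
      ∀ ν, MemP1 x₀ ν → ∀ r : ℝ, φ ν ≤ r → u ≤ ∫ x, f x ∂ν + b * r := by
  let S : Set (V0 x₀ × ℝ) := {q | ∃ ν, MemP1 x₀ ν ∧ q.1.1 = JJ ν - JJ (Measure.dirac x₀) ∧
    φ ν ≤ (q.2 : ℝ)}
  have hS : Convex ℝ S := by
    rintro ⟨v, r⟩ ⟨ν, hν, e, h⟩ ⟨v', r'⟩ ⟨ν', hν', e', h'⟩ s t hs ht hst
    obtain rfl : t = 1 - s := by linarith
    have hs1 : s ≤ 1 := by linarith
    refine ⟨_, hν.mix hν' hs hs1, ?_, ?_⟩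
    · have := hν.1
      have := hν'.1
      have := Measure.smul_finite ν (c := ENNReal.ofReal s) (by simp)
      have := Measure.smul_finite ν' (c := ENNReal.ofReal (1 - s)) (by simp)
      rw [JJ_add, JJ_smul _ hs, JJ_smul _ ht]
      simp only at e e'
      simp only [Prod.fst_add, Prod.smul_fst, Submodule.coe_add, Submodule.coe_smul, e, e']
      module
    · refine (hconv ν hν ν' hν' s hs hs1).trans ?_
      have n1 := hbot ν hν
      have n2 := hbot ν' hν'
      simp only at h h'
      generalize φ ν = y at *
      generalize φ ν' = z at *
      lift y to ℝ using ⟨fun hh => by simp [hh] at h, n1⟩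
      lift z to ℝ using ⟨fun hh => by simp [hh] at h', n2⟩
      norm_cast at h h' ⊢
      simp only [Prod.snd_add, Prod.smul_snd, smul_eq_mul]
      gcongr
  have hmem : ∀ ν, MemP1 x₀ ν → JJ ν - JJ (Measure.dirac x₀) ∈ V0 x₀ := fun ν hν => KR_base hν
  obtain ⟨ε, hε, hsep⟩ : ∃ ε : ℝ, 0 < ε ∧ ∀ q ∈ S,
      krSemi x₀ (q.1 - ⟨_, hmem μ hμ⟩) < ε → |q.2 - a| < ε → False := by
    by_contra! hcon
    choose q hqS hq1 hq2 using fun n : ℕ => hcon (1 / ((n : ℝ) + 1)) (by positivity)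
    choose ν hν e hr using hqS
    have hW : Tendsto (fun n => W1 (ν n) μ) atTop (𝓝 0) := by
      refine squeeze_zero (fun n => W1_nonneg _ _) (fun n => ?_)
        (tendsto_one_div_add_atTop_nhds_zero_nat (𝕜 := ℝ))
      obtain ⟨d, hd, hK⟩ := krSemi_lt (hq1 n)
      refine (W1_le_KR (hν n) hμ ?_).trans hd.le
      convert hK using 1
      simp [e]
    have h1 := hlsc ν hν μ hμ hW
    have h2 : Tendsto (fun n => ((q n).2 : EReal)) atTop (𝓝 (a : EReal)) := by
      refine (continuous_coe_real_ereal.tendsto a).comp ?_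
      rw [tendsto_iff_dist_tendsto_zero]
      exact squeeze_zero (fun n => dist_nonneg) (fun n => (hq2 n).1.le)
        (tendsto_one_div_add_atTop_nhds_zero_nat (𝕜 := ℝ))
    have h3 : liminf (fun n => φ (ν n)) atTop ≤ liminf (fun n => ((q n).2 : EReal)) atTop :=
      liminf_le_liminf (Eventually.of_forall hr)
    rw [h2.liminf_eq] at h3
    exact absurd (h1.trans h3) (not_le.2 ha)
  obtain ⟨l, C, b, u, hl, h1, h2⟩ := hb_sep (krSemi x₀) S hS _ a ε hε hsep
  obtain ⟨g, hg⟩ := l.exists_extend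
  have hg' : ∀ v : V0 x₀, g v.1 = l v := fun v => LinearMap.congr_fun hg v
  obtain ⟨f, hf, hfr⟩ := repr_lip (x₀ := x₀) g C (by
    intro v c h
    rw [hg' ⟨v, c, h⟩]
    exact (hl _).trans (mul_le_mul_of_nonneg_left (krSemi_le h) C.2))
  refine ⟨f, C, b, u, hf, ?_, ?_⟩
  · rw [← hfr μ hμ, hg' ⟨_, hmem μ hμ⟩]; exact h1
  · intro ν hν r hr
    rw [← hfr ν hν, hg' ⟨_, hmem ν hν⟩]
    exact h2 (⟨_, hmem ν hν⟩, r) ⟨ν, hν, rfl, hr⟩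

theorem minor_le (x₀ : X) (φ : Measure X → EReal)
    (ρ : (X → ℝ) → EReal)
    (hρ : ∀ f : X → ℝ, ρ f = ⨆ ν : {ν : Measure X // MemP1 x₀ ν},
      (((∫ x, f x ∂ν.1 : ℝ) : EReal) - φ ν.1))
    (μ : Measure X) (a : ℝ) (f : X → ℝ) (C : ℝ≥0) (hf : LipschitzWith C f) (c : ℝ)
    (h : ∀ ν, MemP1 x₀ ν → ∀ r : ℝ, φ ν ≤ r → ∫ x, f x ∂ν + c ≤ r) (hbot : ∀ ν, MemP1 x₀ ν → φ ν ≠ ⊥)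
    (ha : a ≤ ∫ x, f x ∂μ + c) :
    (a : EReal) ≤ ⨆ f : {f : X → ℝ // ∃ K : ℝ≥0, LipschitzWith K f},
        (((∫ x, f.1 x ∂μ : ℝ) : EReal) - ρ f.1) := by
  refine le_trans ?_ (le_iSup _ ⟨f, C, hf⟩)
  have hr : ρ f ≤ ((-c : ℝ) : EReal) := by
    rw [hρ]
    refine iSup_le ?_
    rintro ⟨ν, hν⟩
    have h1 := h ν hν
    have h2 := hbot ν hν
    simp only
    generalize φ ν = y at *
    induction y with
    | bot => exact absurd rfl h2
    | top => simp
    | coe y =>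
      have := h1 y le_rfl
      norm_cast
      linarith
  calc (a : EReal) ≤ ((∫ x, f x ∂μ - (-c) : ℝ) : EReal) := by
        norm_cast; linarith
    _ = ((∫ x, f x ∂μ : ℝ) : EReal) - ((-c : ℝ) : EReal) := by rw [EReal.coe_sub]
    _ ≤ _ := EReal.sub_le_sub le_rfl hr

end helpers

/-- Fenchel–Moreau duality on the Wasserstein space: a proper, convex,
`W₁`-lower semicontinuous `φ : P₁ → ℝ ∪ {+∞}` equals its biconjugate
`φᶜ(μ) = sup_f (∫ f dμ − ρ(f))`, the suprema being over Lipschitz `f`, where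
`ρ(f) = sup_{ν ∈ P₁} (∫ f dν − φ(ν))`. -/
theorem stmt_15 {X : Type*} [MetricSpace X] [TopologicalSpace.SeparableSpace X]
    [CompleteSpace X] [MeasurableSpace X] [BorelSpace X] (x₀ : X)
    (φ : Measure X → EReal) (hbot : ∀ μ, MemP1 x₀ μ → φ μ ≠ ⊥)
    (hproper : ∃ μ, MemP1 x₀ μ ∧ φ μ ≠ ⊤)
    (hconv : ∀ μ, MemP1 x₀ μ → ∀ ν, MemP1 x₀ ν → ∀ t : ℝ, 0 ≤ t → t ≤ 1 →
      φ ((ENNReal.ofReal t) • μ + (ENNReal.ofReal (1 - t)) • ν) ≤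
        (t : EReal) * φ μ + ((1 - t : ℝ) : EReal) * φ ν)
    (hlsc : ∀ μ : ℕ → Measure X, (∀ n, MemP1 x₀ (μ n)) → ∀ ν, MemP1 x₀ ν →
      Filter.Tendsto (fun n => W1 (μ n) ν) Filter.atTop (nhds 0) →
      φ ν ≤ Filter.liminf (fun n => φ (μ n)) Filter.atTop)
    (ρ : (X → ℝ) → EReal)
    (hρ : ∀ f : X → ℝ, ρ f = ⨆ ν : {ν : Measure X // MemP1 x₀ ν},
      (((∫ x, f x ∂ν.1 : ℝ) : EReal) - φ ν.1)) :
    ∀ μ, MemP1 x₀ μ →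
      φ μ = ⨆ f : {f : X → ℝ // ∃ K : ℝ≥0, LipschitzWith K f},
        (((∫ x, f.1 x ∂μ : ℝ) : EReal) - ρ f.1) := by
  have : SecondCountableTopology X := UniformSpace.secondCountable_of_separable X
  have : PolishSpace X := inferInstance
  have : StandardBorelSpace X := inferInstance
  intro μ hμ
  have sep := sep_main x₀ φ hbot hconv hlsc
  apply le_antisymm
  · -- an affine minorant
    obtain ⟨ν₁, hν₁, hfin⟩ := hproper
    obtain ⟨y, hy⟩ : ∃ y : ℝ, φ ν₁ = y := ⟨_, (EReal.coe_toReal hfin (hbot _ hν₁)).symm⟩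
    have nonneg : ∀ (f : X → ℝ) (b u : ℝ), (∀ ν, MemP1 x₀ ν → ∀ r : ℝ, φ ν ≤ r →
        u ≤ ∫ x, f x ∂ν + b * r) → 0 ≤ b := by
      intro f b u h
      by_contra! hb
      obtain ⟨n, hn⟩ := exists_nat_gt ((∫ x, f x ∂ν₁ + b * y - u) / (-b))
      rw [div_lt_iff₀ (by linarith)] at hn
      have := h ν₁ hν₁ (y + n) (by rw [hy]; norm_cast; simp)
      nlinarith
    have conv : ∀ (f : X → ℝ) (C : ℝ≥0) (b u : ℝ), LipschitzWith C f → 0 < b →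
        (∀ ν, MemP1 x₀ ν → ∀ r : ℝ, φ ν ≤ r → u ≤ ∫ x, f x ∂ν + b * r) →
        ∃ C' : ℝ≥0, LipschitzWith C' (fun x => (-b⁻¹) * f x) ∧
          ∀ ν, MemP1 x₀ ν → ∀ r : ℝ, φ ν ≤ r → ∫ x, (-b⁻¹) * f x ∂ν + u / b ≤ r := by
      intro f C b u hf hb h
      refine ⟨_, (lipschitzWith_smul (-b⁻¹ : ℝ)).comp hf, ?_⟩
      intro ν hν r hr
      rw [integral_const_mul]
      have := h ν hν r hr
      have e : -b⁻¹ * ∫ x, f x ∂ν + u / b = (u - ∫ x, f x ∂ν) / b := by field_simp; ring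
      rw [e, div_le_iff₀ hb]
      linarith
    have main : ∀ a : ℝ, (a : EReal) < φ μ → (a : EReal) ≤
        ⨆ f : {f : X → ℝ // ∃ K : ℝ≥0, LipschitzWith K f},
        (((∫ x, f.1 x ∂μ : ℝ) : EReal) - ρ f.1) := by
      intro a ha
      obtain ⟨f, C, b, u, hf, h1, h2⟩ := sep μ hμ a ha
      rcases (nonneg f b u h2).eq_or_lt with hb | hb
      · subst hb
        obtain ⟨g, C₁, b₁, u₁, hg, k1, k2⟩ := sep ν₁ hν₁ (y - 1) (by
          rw [hy]; norm_cast; linarith)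
        have hb₁ : 0 < b₁ := by
          have := k2 ν₁ hν₁ y hy.le
          linarith
        obtain ⟨C', hg', hm⟩ := conv g C₁ b₁ u₁ hg hb₁ k2
        set G : X → ℝ := fun x => (-b₁⁻¹) * g x
        obtain ⟨n, hn⟩ := exists_nat_gt ((a - (∫ x, G x ∂μ + u₁ / b₁)) / (u - ∫ x, f x ∂μ))
        rw [div_lt_iff₀ (by linarith)] at hn
        have hint : ∀ ν, MemP1 x₀ ν → ∫ x, (G x + (-(n : ℝ)) * f x) ∂ν
            = ∫ x, G x ∂ν - n * ∫ x, f x ∂ν := by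
          intro ν hν
          rw [integral_add (lip_int hg' hν) ((lip_int hf hν).const_mul _),
            integral_const_mul (-(n : ℝ)) f]
          ring
        refine minor_le x₀ φ ρ hρ μ a (fun x => G x + (-(n : ℝ)) * f x) _
          (hg'.add ((lipschitzWith_smul (-(n : ℝ))).comp hf)) (u₁ / b₁ + n * u) ?_ hbot ?_
        · intro ν hν r hr
          rw [hint ν hν]
          have t1 := hm ν hν r hr
          have t2 := h2 ν hν r hr
          have t3 : (0 : ℝ) ≤ n := Nat.cast_nonneg n
          nlinarith
        · rw [hint μ hμ]
          linarith
      · obtain ⟨C', hf', hm⟩ := conv f C b u hf hb h2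
        refine minor_le x₀ φ ρ hρ μ a _ C' hf' (u / b) hm hbot ?_
        rw [integral_const_mul]
        have e : -b⁻¹ * ∫ x, f x ∂μ + u / b = (u - ∫ x, f x ∂μ) / b := by field_simp; ring
        rw [e, le_div_iff₀ hb]
        linarith
    by_contra! hlt
    obtain ⟨a, h1, h2⟩ := EReal.lt_iff_exists_real_btwn.1 hlt
    exact absurd (main a h2) (not_le.2 h1)
  · refine iSup_le ?_
    rintro ⟨f, K, hf⟩
    have h1 : ((∫ x, f x ∂μ : ℝ) : EReal) - φ μ ≤ ρ f := by
      rw [hρ]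
      exact le_iSup (fun ν : {ν : Measure X // MemP1 x₀ ν} =>
        (((∫ x, f x ∂ν.1 : ℝ) : EReal) - φ ν.1)) ⟨μ, hμ⟩
    have h2 := hbot μ hμ
    simp only
    generalize φ μ = y at *
    generalize ρ f = z at *
    induction y with
    | bot => exact absurd rfl h2
    | top => simp
    | coe y =>
      induction z with
      | bot => norm_cast at h1
      | top => simp
      | coe z =>
        norm_cast at h1 ⊢
        linarith
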